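/- arXiv:1712.09962 — 8 statements merged into one kernel-verified Lean document; each statement's English description precedes it below -/
import Mathlib

section
/- Let d ≥ 3 and K > 0. Suppose that for every Schwartz function g : ℝ^d → ℂ one has the Gagliardo–Nirenberg inequality ‖g‖_{2(d+1)/(d-1)}^{2(d+1)/(d-1)} ≤ ((d+1)/d) · (‖g‖_2 ‖∇g‖_2 / K)^{2/(d-1)} · ‖∇g‖_2². Then for every Schwartz function f : ℝ^d → ℂ and every ξ ∈ ℝ^d one has the refined inequality ‖f‖_{2(d+1)/(d-1)}^{2(d+1)/(d-1)} ≤ ((d+1)/d) · (‖f‖_2 ‖∇f‖_2 / K)^{2/(d-1)} · ‖∇(e^{i⟨x,ξ⟩} f)‖_2², where e^{i⟨x,ξ⟩} f denotes the function x ↦ e^{i⟨x,ξ⟩} f(x). -/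
open MeasureTheory Complex
open scoped BigOperators RealInnerProductSpace

/-- The plane wave `t ↦ exp (i t)` on the real line has temperate growth. -/
theorem hasTemperateGrowth_cexp_I_mul_ofReal :
    (fun t : ℝ => Complex.exp (Complex.I * t)).HasTemperateGrowth := by
  refine ⟨(contDiff_const.mul Complex.ofRealCLM.contDiff).cexp, fun n => ⟨0, 1, fun t => ?_⟩⟩
  have h : iteratedDeriv n (fun t : ℝ => Complex.exp (Complex.I * t))
      = fun t : ℝ => Complex.I ^ n * Complex.exp (Complex.I * t) := by
    induction n with
    | zero => simp
    | succ n ih =>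
      rw [iteratedDeriv_succ, ih]
      ext t
      have hlin : HasDerivAt (fun t : ℝ => Complex.I * (t : ℂ)) Complex.I t := by
        simpa using (Complex.ofRealCLM.hasDerivAt (x := t)).const_mul Complex.I
      rw [(hlin.cexp.const_mul (Complex.I ^ n)).deriv]
      ring
  rw [norm_iteratedFDeriv_eq_norm_iteratedDeriv, h]
  simp [mul_comm Complex.I, Complex.norm_exp_ofReal_mul_I]

/-- Modulation by a plane wave preserves Schwartz functions. -/
theorem SchwartzMap.exists_modulation {E : Type*} [NormedAddCommGroup E] [InnerProductSpace ℝ E]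
    (f : SchwartzMap E ℂ) (ξ : E) :
    ∃ g : SchwartzMap E ℂ, ⇑g = fun y => Complex.exp (Complex.I * (⟪y, ξ⟫ : ℝ)) * f y := by
  have h : (fun y : E => Complex.exp (Complex.I * (⟪y, ξ⟫ : ℝ))).HasTemperateGrowth :=
    hasTemperateGrowth_cexp_I_mul_ofReal.comp (by fun_prop)
  exact ⟨SchwartzMap.smulLeftCLM ℂ _ f, SchwartzMap.smulLeftCLM_apply h f⟩

/-- refined Gagliardo–Nirenberg inequality with Galilean modulation. -/
theorem refined_gagliardo_nirenberg
    (d : ℕ) (hd : 3 ≤ d) (K : ℝ) (hK : 0 < K)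
    (hGN : ∀ g : SchwartzMap (EuclideanSpace ℝ (Fin d)) ℂ,
      (∫ x : EuclideanSpace ℝ (Fin d), ‖g x‖ ^ ((2 * ((d : ℝ) + 1)) / ((d : ℝ) - 1)))
        ≤ (((d : ℝ) + 1) / d)
          * ((((∫ x : EuclideanSpace ℝ (Fin d), ‖g x‖ ^ 2) ^ ((1 : ℝ) / 2))
              * ((∫ x : EuclideanSpace ℝ (Fin d),
                    ∑ j : Fin d, ‖fderiv ℝ (⇑g) x (EuclideanSpace.single j 1)‖ ^ 2)
                  ^ ((1 : ℝ) / 2))) / K) ^ ((2 : ℝ) / ((d : ℝ) - 1))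
          * (∫ x : EuclideanSpace ℝ (Fin d),
              ∑ j : Fin d, ‖fderiv ℝ (⇑g) x (EuclideanSpace.single j 1)‖ ^ 2))
    (f : SchwartzMap (EuclideanSpace ℝ (Fin d)) ℂ) (ξ : EuclideanSpace ℝ (Fin d)) :
    (∫ x : EuclideanSpace ℝ (Fin d), ‖f x‖ ^ ((2 * ((d : ℝ) + 1)) / ((d : ℝ) - 1)))
      ≤ (((d : ℝ) + 1) / d)
        * ((((∫ x : EuclideanSpace ℝ (Fin d), ‖f x‖ ^ 2) ^ ((1 : ℝ) / 2))
            * ((∫ x : EuclideanSpace ℝ (Fin d),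
                  ∑ j : Fin d, ‖fderiv ℝ (⇑f) x (EuclideanSpace.single j 1)‖ ^ 2)
                ^ ((1 : ℝ) / 2))) / K) ^ ((2 : ℝ) / ((d : ℝ) - 1))
        * (∫ x : EuclideanSpace ℝ (Fin d),
            ∑ j : Fin d,
              ‖fderiv ℝ (fun y : EuclideanSpace ℝ (Fin d) =>
                  Complex.exp (Complex.I * (⟪y, ξ⟫ : ℝ)) * f y) x
                (EuclideanSpace.single j 1)‖ ^ 2) := by
  obtain ⟨g, hg⟩ := f.exists_modulation ξ
  have hnorm : ∀ x, ‖g x‖ = ‖f x‖ := fun x => by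
    simp [hg, mul_comm Complex.I, Complex.norm_exp_ofReal_mul_I]
  have hf_le := hGN f
  have hg_le := hGN g
  simp only [hnorm] at hg_le
  rw [← hg]
  have hd' : (3 : ℝ) ≤ d := by exact_mod_cast hd
  have hexp : 0 ≤ (2 : ℝ) / ((d : ℝ) - 1) := div_nonneg zero_le_two (by linarith)
  have hnonneg : ∀ h : SchwartzMap (EuclideanSpace ℝ (Fin d)) ℂ,
      0 ≤ ∫ x : EuclideanSpace ℝ (Fin d),
        ∑ j : Fin d, ‖fderiv ℝ (⇑h) x (EuclideanSpace.single j 1)‖ ^ 2 :=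
    fun h => integral_nonneg fun x => Finset.sum_nonneg fun j _ => by positivity
  have hf_nonneg := hnonneg f
  have hg_nonneg := hnonneg g
  have hmass : 0 ≤ ∫ x : EuclideanSpace ℝ (Fin d), ‖f x‖ ^ 2 :=
    integral_nonneg fun x => by positivity
  -- Apply the hypothesis to whichever of `f` and its modulation has the smaller gradient.
  rcases le_total
    (∫ x : EuclideanSpace ℝ (Fin d),
      ∑ j : Fin d, ‖fderiv ℝ (⇑f) x (EuclideanSpace.single j 1)‖ ^ 2)
    (∫ x : EuclideanSpace ℝ (Fin d),
      ∑ j : Fin d, ‖fderiv ℝ (⇑g) x (EuclideanSpace.single j 1)‖ ^ 2) with hle | hle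
  · refine hf_le.trans ?_
    gcongr
  · refine hg_le.trans ?_
    gcongr
end

section
/- Let d ≥ 3 and let Q : ℝ^d → ℝ be a Schwartz function satisfying the elliptic equation −ΔQ(x) + Q(x) = |Q(x)|^{4/(d-1)} Q(x) for all x ∈ ℝ^d. Then (d−2) ∫_{ℝ^d} |∇Q(x)|² dx + d ∫_{ℝ^d} Q(x)² dx = (d(d−1)/(d+1)) ∫_{ℝ^d} |Q(x)|^{2(d+1)/(d-1)} dx. -/
open MeasureTheory
open scoped BigOperators

namespace SchwartzMap

open scoped LineDeriv SchwartzMap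

variable {d : ℕ}

/-- Multiplication of a Schwartz function by the `i`-th coordinate. -/
noncomputable def coordMul (i : Fin d) (f : 𝓢(EuclideanSpace ℝ (Fin d), ℝ)) :
    𝓢(EuclideanSpace ℝ (Fin d), ℝ) :=
  smulLeftCLM ℝ (fun x : EuclideanSpace ℝ (Fin d) => EuclideanSpace.proj (𝕜 := ℝ) i x) f

theorem coordMul_apply (i : Fin d) (f : 𝓢(EuclideanSpace ℝ (Fin d), ℝ))
    (x : EuclideanSpace ℝ (Fin d)) : coordMul i f x = x i * f x := by
  rw [coordMul, smulLeftCLM_apply_apply (by fun_prop)]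
  rfl

/-- The `j`-th partial derivative of a Schwartz function. -/
noncomputable def partialDeriv (j : Fin d) (f : 𝓢(EuclideanSpace ℝ (Fin d), ℝ)) :
    𝓢(EuclideanSpace ℝ (Fin d), ℝ) :=
  ∂_{EuclideanSpace.single j (1 : ℝ)} f

theorem partialDeriv_apply (j : Fin d) (f : 𝓢(EuclideanSpace ℝ (Fin d), ℝ))
    (x : EuclideanSpace ℝ (Fin d)) :
    partialDeriv j f x = fderiv ℝ f x (EuclideanSpace.single j 1) := rfl

theorem partialDeriv_coordMul_apply (i j : Fin d) (f : 𝓢(EuclideanSpace ℝ (Fin d), ℝ))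
    (x : EuclideanSpace ℝ (Fin d)) :
    partialDeriv j (coordMul i f) x
      = (if i = j then f x else 0) + x i * partialDeriv j f x := by
  have h := ((EuclideanSpace.proj i : EuclideanSpace ℝ (Fin d) →L[ℝ] ℝ).hasFDerivAt (x := x)).mul
    (f.hasFDerivAt x)
  replace h : HasFDerivAt (coordMul i f) _ x :=
    h.congr_of_eventuallyEq (Filter.Eventually.of_forall fun y => coordMul_apply i f y)
  rw [partialDeriv_apply, partialDeriv_apply, h.fderiv]
  by_cases hij : i = j <;> simp [hij, add_comm]

theorem integrable_mul (f g : 𝓢(EuclideanSpace ℝ (Fin d), ℝ)) :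
    Integrable (fun x => f x * g x) :=
  (bilinLeftCLM (ContinuousLinearMap.mul ℝ ℝ) g.hasTemperateGrowth f).integrable

theorem integrable_coord_mul_mul (i : Fin d) (f g : 𝓢(EuclideanSpace ℝ (Fin d), ℝ)) :
    Integrable (fun x => x i * f x * g x) := by
  simpa only [coordMul_apply] using integrable_mul (coordMul i f) g

/-- Integration by parts against a coordinate weight. -/
theorem integral_coord_mul_mul_partialDeriv (i j : Fin d)
    (f g : 𝓢(EuclideanSpace ℝ (Fin d), ℝ)) :
    ∫ x, x i * f x * partialDeriv j g x
      = -(if i = j then ∫ x, f x * g x else 0)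
        - ∫ x, x i * partialDeriv j f x * g x := by
  have h : ∫ x, coordMul i f x * partialDeriv j g x = -∫ x, partialDeriv j (coordMul i f) x * g x :=
    integral_mul_lineDerivOp_right_eq_neg_left _ _ _
  simp only [coordMul_apply, partialDeriv_coordMul_apply, add_mul] at h
  rw [h]
  by_cases hij : i = j
  · simp only [hij, if_true]
    rw [integral_add (integrable_mul f g) (integrable_coord_mul_mul j _ g)]
    ring
  · simp [hij]

theorem integral_coord_mul_partialDeriv_mul_self (i : Fin d)
    (f : 𝓢(EuclideanSpace ℝ (Fin d), ℝ)) :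
    ∫ x, x i * partialDeriv i f x * f x = -(1 / 2) * ∫ x, f x ^ 2 := by
  have h := integral_coord_mul_mul_partialDeriv i i f f
  have e : ∀ x, x i * f x * partialDeriv i f x
      = x i * partialDeriv i f x * f x := fun x => by ring
  simp only [e, if_true, ← sq] at h
  linarith

theorem partialDeriv_comm (i j : Fin d) (f : 𝓢(EuclideanSpace ℝ (Fin d), ℝ)) :
    partialDeriv i (partialDeriv j f) = partialDeriv j (partialDeriv i f) := by
  ext x
  have key : ∀ i j : Fin d, partialDeriv i (partialDeriv j f) x
      = fderiv ℝ (fderiv ℝ f) x (EuclideanSpace.single i 1) (EuclideanSpace.single j 1) :=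
    fun i j => by
    have h := ((fderivCLM ℝ _ ℝ f).hasFDerivAt x).clm_apply
      (hasFDerivAt_const (EuclideanSpace.single j (1 : ℝ)) x)
    have h' : fderiv ℝ (partialDeriv j f) x = _ := h.fderiv
    rw [partialDeriv_apply, h']
    simp
    rfl
  rw [key, key]
  exact (f.smooth 2).contDiffAt.isSymmSndFDerivAt (by simp) _ _

theorem integral_coord_mul_partialDeriv_mul_partialDeriv_partialDeriv (i j : Fin d)
    (f : 𝓢(EuclideanSpace ℝ (Fin d), ℝ)) :
    ∫ x, x i * partialDeriv i f x
        * partialDeriv j (partialDeriv j f) x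
      = -(if i = j then ∫ x, (partialDeriv j f x) ^ 2 else 0)
        + 1 / 2 * ∫ x, (partialDeriv j f x) ^ 2 := by
  rw [integral_coord_mul_mul_partialDeriv, partialDeriv_comm,
    integral_coord_mul_partialDeriv_mul_self]
  by_cases hij : i = j
  · simp only [hij, if_true, ← sq]
    ring
  · simp [hij]

/-- If `N = |f| ^ (q - 2) * f` is Schwartz, integrating it against `x i * ∂ᵢ f` gives
`-1 / q` times the integral of `|f| ^ q`. -/
theorem integral_coord_mul_partialDeriv_mul_abs_rpow {q : ℝ} (hq : 1 < q) (i : Fin d)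
    (f N : 𝓢(EuclideanSpace ℝ (Fin d), ℝ)) (hN : ∀ x, N x = |f x| ^ (q - 2) * f x) :
    ∫ x, x i * partialDeriv i f x * N x
      = -(1 / q) * ∫ x, |f x| ^ q := by
  have hNf : ∀ x, N x * f x = |f x| ^ q := fun x => by
    rw [hN]
    rcases eq_or_ne (f x) 0 with h | h
    · rw [h, mul_zero, abs_zero, Real.zero_rpow (by linarith)]
    · rw [mul_assoc, ← sq, ← sq_abs, ← Real.rpow_natCast, ← Real.rpow_add (abs_pos.2 h)]
      norm_num
  have hderiv : ∀ x, partialDeriv i N x * f x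
      = (q - 1) * (partialDeriv i f x * N x) := fun x => by
    have h1 := (N.hasFDerivAt x).mul (f.hasFDerivAt x)
    have h2 : HasFDerivAt (fun y => N y * f y) _ x :=
      ((hasDerivAt_abs_rpow (f x) hq).comp_hasFDerivAt x (f.hasFDerivAt x)).congr_of_eventuallyEq
        (Filter.Eventually.of_forall hNf)
    have h := congrArg (fun L => L (EuclideanSpace.single i (1 : ℝ))) (h1.unique h2)
    simp only [_root_.add_apply, _root_.smul_apply, smul_eq_mul] at h
    rw [mul_assoc q, ← hN] at h
    simp only [partialDeriv_apply]
    linarith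
  have h := integral_coord_mul_mul_partialDeriv i i N f
  have e1 : ∀ x, x i * N x * partialDeriv i f x
      = x i * partialDeriv i f x * N x := fun x => by ring
  have e2 : ∀ x, x i * partialDeriv i N x * f x
      = (q - 1) * (x i * partialDeriv i f x * N x) := fun x => by
    rw [mul_assoc, hderiv]
    ring
  simp only [e1, e2, if_true, hNf, integral_const_mul] at h
  have hq0 : q ≠ 0 := by linarith
  field_simp
  linarith

/-- The Pohozaev identity for `-Δ f + f = |f| ^ (q - 2) f`. -/
theorem pohozaev_of_schwartz {q : ℝ} (hq : 1 < q) (f : 𝓢(EuclideanSpace ℝ (Fin d), ℝ))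
    (hf : ∀ x, -(∑ j : Fin d, partialDeriv j
        (partialDeriv j f) x) + f x = |f x| ^ (q - 2) * f x) :
    ((d : ℝ) - 2) * (∫ x, ∑ j : Fin d, (partialDeriv j f x) ^ 2)
      + d * (∫ x, f x ^ 2) = (2 * d / q) * ∫ x, |f x| ^ q := by
  set N : 𝓢(EuclideanSpace ℝ (Fin d), ℝ) :=
    f - ∑ j : Fin d, partialDeriv j (partialDeriv j f) with hNdef
  have hNf : ∀ x, f x = (∑ j : Fin d, partialDeriv j
      (partialDeriv j f) x) + N x := fun x => by
    simp [hNdef, sum_apply]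
  have hN : ∀ x, N x = |f x| ^ (q - 2) * f x := fun x => by
    rw [← hf, eq_neg_add_iff_add_eq, ← hNf]
  have key : ∀ i : Fin d, -(1 / 2) * ∫ x, f x ^ 2
      = (-(∫ x, (partialDeriv i f x) ^ 2)
        + ∑ j, 1 / 2 * ∫ x, (partialDeriv j f x) ^ 2)
        + -(1 / q) * ∫ x, |f x| ^ q := fun i => by
    rw [← integral_coord_mul_partialDeriv_mul_self i f,
      ← integral_coord_mul_partialDeriv_mul_abs_rpow hq i f N hN]
    calc ∫ x, x i * partialDeriv i f x * f x
        = ∫ x, ((∑ j, x i * partialDeriv i f x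
          * partialDeriv j (partialDeriv j f) x)
          + x i * partialDeriv i f x * N x) := by
          refine integral_congr_ae (Filter.Eventually.of_forall fun x => ?_)
          simp only [← Finset.mul_sum, ← mul_add, ← hNf]
      _ = _ := by
          rw [integral_add (integrable_finsetSum _ fun j _ => integrable_coord_mul_mul i _ _)
            (integrable_coord_mul_mul i _ _),
            integral_finsetSum _ fun j _ => integrable_coord_mul_mul i _ _]
          simp only [integral_coord_mul_partialDeriv_mul_partialDeriv_partialDeriv,
            Finset.sum_add_distrib, Finset.sum_neg_distrib]
          simp
  have hsum := Finset.sum_congr (rfl : (Finset.univ : Finset (Fin d)) = _) fun i _ => key i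
  rw [integral_finsetSum _ fun j _ => by simpa only [sq] using integrable_mul _ _]
  simp only [Finset.sum_add_distrib, Finset.sum_neg_distrib, Finset.sum_const, Finset.card_univ,
    Fintype.card_fin, nsmul_eq_mul, ← Finset.mul_sum] at hsum
  have hq0 : q ≠ 0 := by linarith
  field_simp at hsum ⊢
  linarith

end SchwartzMap

/-- second Pohozaev identity for the ground state equation. -/
theorem pohozaev_second
    (d : ℕ) (hd : 3 ≤ d) (Q : SchwartzMap (EuclideanSpace ℝ (Fin d)) ℝ)
    (hQ : ∀ x : EuclideanSpace ℝ (Fin d),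
      -(∑ j : Fin d,
          fderiv ℝ (fun y : EuclideanSpace ℝ (Fin d) =>
              fderiv ℝ (⇑Q) y (EuclideanSpace.single j 1)) x (EuclideanSpace.single j 1))
        + Q x = |Q x| ^ ((4 : ℝ) / ((d : ℝ) - 1)) * Q x) :
    ((d : ℝ) - 2) * (∫ x : EuclideanSpace ℝ (Fin d),
        ∑ j : Fin d, (fderiv ℝ (⇑Q) x (EuclideanSpace.single j 1)) ^ 2)
      + (d : ℝ) * (∫ x : EuclideanSpace ℝ (Fin d), (Q x) ^ 2)
      = ((d : ℝ) * ((d : ℝ) - 1) / ((d : ℝ) + 1))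
        * ∫ x : EuclideanSpace ℝ (Fin d), |Q x| ^ ((2 * ((d : ℝ) + 1)) / ((d : ℝ) - 1)) := by
  have hd' : (3 : ℝ) ≤ d := by exact_mod_cast hd
  have hd1 : (0 : ℝ) < d - 1 := by linarith
  have hexp : (4 : ℝ) / ((d : ℝ) - 1) = 2 * ((d : ℝ) + 1) / ((d : ℝ) - 1) - 2 := by
    field_simp
    ring
  have hq : 1 < 2 * ((d : ℝ) + 1) / ((d : ℝ) - 1) := by
    rw [lt_div_iff₀ hd1]
    linarith
  have hcoef : (d : ℝ) * ((d : ℝ) - 1) / ((d : ℝ) + 1)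
      = 2 * d / (2 * ((d : ℝ) + 1) / ((d : ℝ) - 1)) := by
    field_simp
  rw [hexp] at hQ
  rw [hcoef]
  exact SchwartzMap.pohozaev_of_schwartz hq Q hQ
end

section
/- Let d ≥ 3, let Q : ℝ^d → ℝ be a Schwartz function, not identically zero, satisfying the elliptic equation −ΔQ(x) + Q(x) = |Q(x)|^{4/(d-1)} Q(x) for all x ∈ ℝ^d, and let C₀ > 0 be a constant such that equality ‖Q‖_{2(d+1)/(d-1)}^{2(d+1)/(d-1)} = C₀ ‖Q‖_2^{2/(d-1)} ‖∇Q‖_2^{2d/(d-1)} holds. Then C₀ = ((d+1)/d) · (‖Q‖_2 ‖∇Q‖_2)^{−2/(d-1)}. -/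
open MeasureTheory
open scoped BigOperators

section SchwartzIdentities

open scoped SchwartzMap LineDeriv

variable {E : Type*} [NormedAddCommGroup E] [NormedSpace ℝ E]

theorem SchwartzMap.lineDerivOp_lineDerivOp_comm (f : 𝓢(E, ℝ)) (v w : E) :
    ∂_{v} (∂_{w} f) = ∂_{w} (∂_{v} f) := by
  have key (a b x : E) : ∂_{a} (∂_{b} f) x = fderiv ℝ (fderiv ℝ f) x a b := by
    have hd : DifferentiableAt ℝ (fderiv ℝ f) x :=
      (SchwartzMap.fderivCLM ℝ E ℝ f).differentiableAt
    rw [SchwartzMap.lineDerivOp_apply_eq_fderiv]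
    change fderiv ℝ (fun y => fderiv ℝ f y b) x a = _
    rw [fderiv_clm_apply hd (differentiableAt_const b)]
    simp
  ext x
  rw [key, key]
  exact ((f.smooth 2).contDiffAt.isSymmSndFDerivAt (by simp)) v w

/-- The product of a Schwartz function with a continuous linear functional. -/
theorem SchwartzMap.exists_clm_mul (ℓ : E →L[ℝ] ℝ) (f : 𝓢(E, ℝ)) :
    ∃ g : 𝓢(E, ℝ), ∀ x, g x = ℓ x * f x :=
  ⟨SchwartzMap.smulLeftCLM ℝ ℓ f, fun x => by
    rw [SchwartzMap.smulLeftCLM_apply_apply (by fun_prop), smul_eq_mul]⟩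

theorem SchwartzMap.exists_mul (f g : 𝓢(E, ℝ)) :
    ∃ h : 𝓢(E, ℝ), ∀ x, h x = f x * g x :=
  ⟨SchwartzMap.smulLeftCLM ℝ f g, fun x => by
    rw [SchwartzMap.smulLeftCLM_apply_apply f.hasTemperateGrowth, smul_eq_mul]⟩

variable [MeasurableSpace E] [BorelSpace E] {μ : Measure E}

theorem SchwartzMap.integrable_abs_rpow_mul (f : 𝓢(E, ℝ)) {q : ℝ} (hq : 0 ≤ q) {g : E → ℝ}
    (hg : Integrable g μ) : Integrable (fun x => |f x| ^ q * g x) μ := by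
  have hc : Continuous fun x => |f x| ^ q := f.continuous.abs.rpow_const fun _ => Or.inr hq
  refine hg.bdd_mul (c := (SchwartzMap.seminorm ℝ 0 0 f) ^ q) hc.aestronglyMeasurable
    (.of_forall fun x => ?_)
  rw [Real.norm_of_nonneg (by positivity)]
  exact Real.rpow_le_rpow (abs_nonneg _) (SchwartzMap.norm_le_seminorm ℝ f x) hq

variable [FiniteDimensional ℝ E] [μ.IsAddHaarMeasure]

theorem SchwartzMap.integrable_mul_s4 (f g : 𝓢(E, ℝ)) : Integrable (fun x => f x * g x) μ := by
  obtain ⟨h, hh⟩ := f.exists_mul g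
  exact (h.integrable (μ := μ)).congr (.of_forall hh)

theorem SchwartzMap.integrable_clm_mul_mul (ℓ : E →L[ℝ] ℝ) (f g : 𝓢(E, ℝ)) :
    Integrable (fun x => ℓ x * (f x * g x)) μ := by
  obtain ⟨h, hh⟩ := f.exists_mul g
  obtain ⟨k, hk⟩ := h.exists_clm_mul ℓ
  exact (k.integrable (μ := μ)).congr (.of_forall fun x => by simp only [hk, hh])

theorem integral_clm_mul_fderiv_apply (ℓ : E →L[ℝ] ℝ) {h : E → ℝ} {h' : E → E →L[ℝ] ℝ} (v : E)
    (hd : ∀ x, HasFDerivAt h (h' x) x) (hi : Integrable h μ)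
    (hℓ : Integrable (fun x => ℓ x * h x) μ) (hℓ' : Integrable (fun x => ℓ x * h' x v) μ) :
    ∫ x, ℓ x * h' x v ∂μ = -(ℓ v * ∫ x, h x ∂μ) := by
  have h1 : ∀ x, fderiv ℝ h x = h' x := fun x => (hd x).fderiv
  have := integral_mul_fderiv_eq_neg_fderiv_mul_of_integrable (μ := μ) (f := ℓ) (g := h) (v := v)
    (by simpa using hi.const_mul (ℓ v)) (by simpa only [h1] using hℓ') hℓ
    (fun x _ => ℓ.differentiableAt) (fun x _ => (hd x).differentiableAt)
  simpa [h1, integral_const_mul] using this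

theorem SchwartzMap.integral_clm_mul_lineDerivOp_mul_self (ℓ : E →L[ℝ] ℝ) (f : 𝓢(E, ℝ)) (v : E) :
    ∫ x, ℓ x * (∂_{v} f x * f x) ∂μ = -(ℓ v / 2 * ∫ x, f x ^ 2 ∂μ) := by
  have h2 (x : E) : HasFDerivAt (fun y => f y ^ 2) ((2 * f x) • fderiv ℝ f x) x := by
    simpa using (f.hasFDerivAt x).pow 2
  have hv (x : E) : ((2 * f x) • fderiv ℝ f x) v = 2 * (∂_{v} f x * f x) := by
    simp [SchwartzMap.lineDerivOp_apply_eq_fderiv]; ring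
  have := integral_clm_mul_fderiv_apply (μ := μ) ℓ v h2
    (by simpa only [sq] using f.integrable_mul_s4 f)
    (by simpa only [sq] using f.integrable_clm_mul_mul ℓ f)
    (by
      simp only [hv, mul_left_comm _ (2 : ℝ)]
      exact ((∂_{v} f).integrable_clm_mul_mul ℓ f).const_mul 2)
  simp only [hv, mul_left_comm _ (2 : ℝ), integral_const_mul] at this
  linarith

theorem SchwartzMap.integral_clm_mul_lineDerivOp_mul_abs_rpow (ℓ : E →L[ℝ] ℝ) (f : 𝓢(E, ℝ))
    (v : E) {q : ℝ} (hq : 0 ≤ q) :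
    ∫ x, |f x| ^ q * (ℓ x * (∂_{v} f x * f x)) ∂μ
      = -(ℓ v / (q + 2) * ∫ x, |f x| ^ q * (f x * f x) ∂μ) := by
  have hpow (t : ℝ) : |t| ^ (q + 2) = |t| ^ q * (t * t) := by
    rw [Real.rpow_add_of_nonneg (abs_nonneg t) hq zero_le_two, Real.rpow_two, sq_abs, sq]
  have hd (x : E) : HasFDerivAt (fun y => |f y| ^ q * (f y * f y))
      (((q + 2) * |f x| ^ q * f x) • fderiv ℝ f x) x := by
    have := (hasDerivAt_abs_rpow (f x) (p := q + 2) (by linarith)).comp_hasFDerivAt x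
      (f.hasFDerivAt x)
    simpa only [add_sub_cancel_right, Function.comp_def, hpow] using this
  have hv (x : E) : ((((q + 2) * |f x| ^ q * f x) • fderiv ℝ f x) v)
      = (q + 2) * (|f x| ^ q * (∂_{v} f x * f x)) := by
    simp [SchwartzMap.lineDerivOp_apply_eq_fderiv]; ring
  have := integral_clm_mul_fderiv_apply (μ := μ) ℓ v hd
    (f.integrable_abs_rpow_mul hq (f.integrable_mul_s4 f))
    (by
      simp only [mul_left_comm (ℓ _)]
      simpa only [mul_left_comm (ℓ _)] using
        f.integrable_abs_rpow_mul hq (f.integrable_clm_mul_mul (μ := μ) ℓ f))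
    (by
      simp only [hv, mul_left_comm (ℓ _) (q + 2), mul_left_comm (ℓ _) (|f _| ^ q)]
      exact (f.integrable_abs_rpow_mul hq ((∂_{v} f).integrable_clm_mul_mul ℓ f)).const_mul _)
  simp only [hv, mul_left_comm (ℓ _) (q + 2), mul_left_comm (ℓ _) (|f _| ^ q),
    integral_const_mul] at this
  have hq2 : q + 2 ≠ 0 := by positivity
  rw [div_mul_eq_mul_div, ← neg_div, eq_div_iff hq2, mul_comm, this]

theorem SchwartzMap.integral_mul_lineDerivOp_lineDerivOp (f : 𝓢(E, ℝ)) (v : E) :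
    ∫ x, f x * ∂_{v} (∂_{v} f) x ∂μ = -∫ x, (∂_{v} f x) ^ 2 ∂μ := by
  simpa only [sq] using f.integral_mul_lineDerivOp_right_eq_neg_left (μ := μ) (∂_{v} f) v

theorem SchwartzMap.integral_clm_mul_lineDerivOp_mul_lineDerivOp_lineDerivOp
    (ℓ : E →L[ℝ] ℝ) (f : 𝓢(E, ℝ)) (v w : E) :
    ∫ x, ℓ x * (∂_{v} f x * ∂_{w} (∂_{w} f) x) ∂μ
      = ℓ v / 2 * (∫ x, (∂_{w} f x) ^ 2 ∂μ) - ℓ w * ∫ x, ∂_{v} f x * ∂_{w} f x ∂μ := by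
  obtain ⟨g, hg⟩ := (∂_{v} f).exists_clm_mul ℓ
  have hgw (x : E) : ∂_{w} g x = ℓ w * ∂_{v} f x + ℓ x * ∂_{v} (∂_{w} f) x := by
    have h1 : HasFDerivAt g (ℓ x • fderiv ℝ (∂_{v} f : 𝓢(E, ℝ)) x + (∂_{v} f x) • ℓ) x := by
      have : (⇑g : E → ℝ) = fun y => ℓ y * ∂_{v} f y := funext hg
      rw [this]
      exact ℓ.hasFDerivAt.mul ((∂_{v} f).hasFDerivAt x)
    rw [SchwartzMap.lineDerivOp_apply_eq_fderiv, h1.fderiv, f.lineDerivOp_lineDerivOp_comm v w,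
      SchwartzMap.lineDerivOp_apply_eq_fderiv w (∂_{v} f)]
    simp; ring
  have h := g.integral_mul_lineDerivOp_right_eq_neg_left (μ := μ) (∂_{w} f) w
  have h3 := (∂_{w} f).integral_clm_mul_lineDerivOp_mul_self (μ := μ) ℓ v
  simp only [hg, hgw, add_mul, mul_assoc] at h
  rw [integral_add (((∂_{v} f).integrable_mul_s4 (∂_{w} f)).const_mul _)
    ((∂_{v} (∂_{w} f)).integrable_clm_mul_mul ℓ (∂_{w} f)), integral_const_mul, h3] at h
  rw [h]; ring

end SchwartzIdentities

section GroundState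

open scoped SchwartzMap LineDeriv

variable {d : ℕ}

/-- The partial derivative of a Schwartz function on Euclidean space. -/
noncomputable abbrev SchwartzMap.pd (j : Fin d) (f : 𝓢(EuclideanSpace ℝ (Fin d), ℝ)) :
    𝓢(EuclideanSpace ℝ (Fin d), ℝ) :=
  ∂_{(EuclideanSpace.single j (1 : ℝ) : EuclideanSpace ℝ (Fin d))} f

open SchwartzMap (pd)

theorem energy_identity {Q : 𝓢(EuclideanSpace ℝ (Fin d), ℝ)} {q : ℝ}
    (hQ : ∀ x, -(∑ j, pd j (pd j Q) x) + Q x = |Q x| ^ q * Q x) :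
    (∫ x, ∑ j, (pd j Q x) ^ 2) + ∫ x, Q x ^ 2 = ∫ x, |Q x| ^ q * (Q x * Q x) := by
  have h1 (x) : |Q x| ^ q * (Q x * Q x) = Q x ^ 2 - ∑ j, Q x * pd j (pd j Q) x := by
    rw [← Finset.mul_sum, ← mul_assoc, ← hQ x]; ring
  simp only [h1]
  rw [integral_sub (by simpa only [sq] using Q.integrable_mul_s4 Q)
    (integrable_finsetSum _ fun j _ => Q.integrable_mul_s4 _),
    integral_finsetSum _ fun j _ => Q.integrable_mul_s4 _,
    integral_finsetSum _ fun j _ => by simpa only [sq] using (pd j Q).integrable_mul_s4 (pd j Q)]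
  simp only [Q.integral_mul_lineDerivOp_lineDerivOp, Finset.sum_neg_distrib]
  ring

theorem pohozaev_identity_coord {Q : 𝓢(EuclideanSpace ℝ (Fin d), ℝ)} {q : ℝ} (hq : 0 ≤ q)
    (hQ : ∀ x, -(∑ j, pd j (pd j Q) x) + Q x = |Q x| ^ q * Q x) (k : Fin d) :
    (∫ x, ∑ j, (pd j Q x) ^ 2) / 2 - (∫ x, (pd k Q x) ^ 2) + (∫ x, Q x ^ 2) / 2
      = (∫ x, |Q x| ^ q * (Q x * Q x)) / (q + 2) := by
  let ℓ : EuclideanSpace ℝ (Fin d) →L[ℝ] ℝ := EuclideanSpace.proj k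
  have h1 (x) : |Q x| ^ q * (ℓ x * (pd k Q x * Q x))
      = ℓ x * (pd k Q x * Q x) - ∑ j, ℓ x * (pd k Q x * pd j (pd j Q) x) := by
    rw [← Finset.mul_sum, ← Finset.mul_sum]
    linear_combination (-(ℓ x * pd k Q x)) * hQ x
  have h2 := Q.integral_clm_mul_lineDerivOp_mul_abs_rpow (μ := volume) ℓ
    (EuclideanSpace.single k 1) hq
  simp only [h1] at h2
  rw [integral_sub ((pd k Q).integrable_clm_mul_mul ℓ Q)
    (integrable_finsetSum _ fun j _ => (pd k Q).integrable_clm_mul_mul ℓ _),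
    integral_finsetSum _ fun j _ => (pd k Q).integrable_clm_mul_mul ℓ _] at h2
  simp only [Q.integral_clm_mul_lineDerivOp_mul_self,
    Q.integral_clm_mul_lineDerivOp_mul_lineDerivOp_lineDerivOp, Finset.sum_sub_distrib] at h2
  rw [integral_finsetSum _ fun j _ => by simpa only [sq] using (pd j Q).integrable_mul_s4 (pd j Q)]
  have h3 (j : Fin d) : ℓ (EuclideanSpace.single j 1) = if k = j then 1 else 0 := by
    simp [ℓ]
  simp only [h3, ite_mul, one_mul, zero_mul, Finset.sum_ite_eq, Finset.mem_univ, if_true,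
    ← Finset.mul_sum, ← sq] at h2
  simp only [← sq]
  linear_combination -h2

theorem pohozaev_identity {Q : 𝓢(EuclideanSpace ℝ (Fin d), ℝ)} {q : ℝ} (hq : 0 ≤ q)
    (hQ : ∀ x, -(∑ j, pd j (pd j Q) x) + Q x = |Q x| ^ q * Q x) :
    ((d : ℝ) - 2) / 2 * (∫ x, ∑ j, (pd j Q x) ^ 2) + d / 2 * (∫ x, Q x ^ 2)
      = d / (q + 2) * ∫ x, |Q x| ^ q * (Q x * Q x) := by
  have h := Finset.sum_congr rfl fun k (_ : k ∈ Finset.univ) => pohozaev_identity_coord hq hQ k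
  have hK : ∑ k, ∫ x, (pd k Q x) ^ 2 = ∫ x, ∑ j, (pd j Q x) ^ 2 :=
    (integral_finsetSum _ fun j _ => by
      simpa only [sq] using (pd j Q).integrable_mul_s4 (pd j Q)).symm
  simp only [Finset.sum_add_distrib, Finset.sum_sub_distrib, Finset.sum_const, Finset.card_univ,
    Fintype.card_fin, nsmul_eq_mul] at h
  rw [hK] at h
  linear_combination h

end GroundState


/-- the sharp Gagliardo–Nirenberg constant in terms of the ground state. -/
theorem sharp_GN_constant
    (d : ℕ) (hd : 3 ≤ d) (Q : SchwartzMap (EuclideanSpace ℝ (Fin d)) ℝ)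
    (hQ0 : ∃ x : EuclideanSpace ℝ (Fin d), Q x ≠ 0)
    (hQ : ∀ x : EuclideanSpace ℝ (Fin d),
      -(∑ j : Fin d,
          fderiv ℝ (fun y : EuclideanSpace ℝ (Fin d) =>
              fderiv ℝ (⇑Q) y (EuclideanSpace.single j 1)) x (EuclideanSpace.single j 1))
        + Q x = |Q x| ^ ((4 : ℝ) / ((d : ℝ) - 1)) * Q x)
    (C₀ : ℝ) (hC₀ : 0 < C₀)
    (heq : (∫ x : EuclideanSpace ℝ (Fin d), |Q x| ^ ((2 * ((d : ℝ) + 1)) / ((d : ℝ) - 1)))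
      = C₀ * ((∫ x : EuclideanSpace ℝ (Fin d), (Q x) ^ 2) ^ ((1 : ℝ) / 2))
              ^ ((2 : ℝ) / ((d : ℝ) - 1))
           * ((∫ x : EuclideanSpace ℝ (Fin d),
                  ∑ j : Fin d, (fderiv ℝ (⇑Q) x (EuclideanSpace.single j 1)) ^ 2)
                ^ ((1 : ℝ) / 2)) ^ ((2 * (d : ℝ)) / ((d : ℝ) - 1))) :
    C₀ = (((d : ℝ) + 1) / d)
      * (((∫ x : EuclideanSpace ℝ (Fin d), (Q x) ^ 2) ^ ((1 : ℝ) / 2))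
          * ((∫ x : EuclideanSpace ℝ (Fin d),
                ∑ j : Fin d, (fderiv ℝ (⇑Q) x (EuclideanSpace.single j 1)) ^ 2)
              ^ ((1 : ℝ) / 2))) ^ (-(2 : ℝ) / ((d : ℝ) - 1)) := by
  have hd1 : (0 : ℝ) < (d : ℝ) - 1 := by
    have : (3 : ℝ) ≤ d := by exact_mod_cast hd
    linarith
  have hd0 : (0 : ℝ) < d := by linarith
  have hq : (0 : ℝ) ≤ 4 / ((d : ℝ) - 1) := by positivity
  have hE := energy_identity hQ
  have hP := pohozaev_identity hq hQ
  have hp : (2 * ((d : ℝ) + 1)) / ((d : ℝ) - 1) = 4 / ((d : ℝ) - 1) + 2 := by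
    field_simp; ring
  have hpow (t : ℝ) :
      |t| ^ ((2 * ((d : ℝ) + 1)) / ((d : ℝ) - 1)) = |t| ^ ((4 : ℝ) / ((d : ℝ) - 1)) * (t * t) := by
    rw [hp, Real.rpow_add_of_nonneg (abs_nonneg t) hq zero_le_two, Real.rpow_two, sq_abs, sq]
  simp only [hpow] at heq
  simp only [SchwartzMap.lineDerivOp_apply_eq_fderiv] at hE hP
  have hMpos : 0 < ∫ x, Q x ^ 2 := by
    obtain ⟨x₀, hx₀⟩ := hQ0
    exact integral_pos_of_integrable_nonneg_nonzero (Q.continuous.pow 2)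
      (by simpa only [sq] using Q.integrable_mul_s4 Q) (fun x => sq_nonneg (Q x))
      (pow_ne_zero 2 hx₀)
  rw [← hp] at hP
  generalize (∫ x, |Q x| ^ ((4 : ℝ) / ((d : ℝ) - 1)) * (Q x * Q x)) = P at *
  generalize (∫ x, Q x ^ 2) = M at *
  generalize (∫ x, ∑ j : Fin d, (fderiv ℝ (⇑Q) x (EuclideanSpace.single j 1)) ^ 2) = K at *
  have hKM : K = d * M := by
    rw [← hE] at hP
    field_simp at hP
    linarith
  have hKpos : 0 < K := hKM ▸ mul_pos hd0 hMpos
  have hPK : P = ((d : ℝ) + 1) / d * K := by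
    rw [← hE, hKM]; field_simp
  rw [hPK] at heq
  rw [← Real.rpow_mul hMpos.le, ← Real.rpow_mul hKpos.le] at heq
  rw [Real.mul_rpow (by positivity) (by positivity), ← Real.rpow_mul hMpos.le,
    ← Real.rpow_mul hKpos.le]
  have hneg : (1 : ℝ) / 2 * (-2 / ((d : ℝ) - 1)) = -(1 / 2 * (2 / ((d : ℝ) - 1))) := by ring
  have hexp : (1 : ℝ) / 2 * (2 * d / ((d : ℝ) - 1)) = 1 + 1 / 2 * (2 / ((d : ℝ) - 1)) := by
    field_simp; ring
  rw [hexp, Real.rpow_add hKpos, Real.rpow_one] at heq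
  rw [hneg, Real.rpow_neg hMpos.le, Real.rpow_neg hKpos.le]
  have hm : 0 < M ^ ((1 : ℝ) / 2 * (2 / ((d : ℝ) - 1))) := Real.rpow_pos_of_pos hMpos _
  have hk : 0 < K ^ ((1 : ℝ) / 2 * (2 / ((d : ℝ) - 1))) := Real.rpow_pos_of_pos hKpos _
  rw [← mul_inv, ← div_eq_mul_inv, eq_div_iff (by positivity)]
  apply mul_right_cancel₀ hKpos.ne'
  linear_combination -heq
end

section
/- Let d ≥ 3, K > 0, and δ ∈ (0,1). Suppose that for every Schwartz function g : ℝ^d → ℂ one has the Gagliardo–Nirenberg inequality ‖g‖_{2(d+1)/(d-1)}^{2(d+1)/(d-1)} ≤ ((d+1)/d) · (‖g‖_2 ‖∇g‖_2 / K)^{2/(d-1)} · ‖∇g‖_2². Then there exists δ' > 0, depending only on δ and d, such that every Schwartz function f : ℝ^d → ℂ satisfying M(f) E(f) < (1−δ) K²/(2d) and ‖f‖_2 ‖∇f‖_2 ≤ K also satisfies ‖f‖_2 ‖∇f‖_2 < (1−δ') K. -/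
open MeasureTheory
open scoped BigOperators

/-- The comparison function `y ↦ y² (d - (d - 1) y ^ (2 / (d - 1)))` exceeds any level below its
value `1` at `y = 1` on a left neighbourhood of `1`. -/
theorem exists_lt_sub_of_comparison_lt (d : ℝ) (δ : ℝ) (hδ : 0 < δ) :
    ∃ δ' : ℝ, 0 < δ' ∧ ∀ y : ℝ, y ≤ 1 →
      y ^ 2 * (d - (d - 1) * y ^ (2 / (d - 1))) < 1 - δ → y < 1 - δ' := by
  have hcont : ContinuousAt (fun y : ℝ => y ^ 2 * (d - (d - 1) * y ^ (2 / (d - 1)))) 1 := by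
    have h : ContinuousAt (fun y : ℝ => y ^ (2 / (d - 1))) 1 :=
      Real.continuousAt_rpow_const 1 _ (Or.inl one_ne_zero)
    fun_prop
  obtain ⟨ε, hε, h⟩ := Metric.continuousAt_iff.1 hcont δ hδ
  refine ⟨ε / 2, by positivity, fun y hy hlt => ?_⟩
  by_contra! hge
  have hy' : dist y 1 < ε := by
    rw [Real.dist_eq, abs_lt]
    constructor <;> linarith
  have key := h hy'
  rw [Real.dist_eq, abs_lt, Real.one_rpow] at key
  linarith [key.1]

theorem SchwartzMap.integrable_norm_rpow {d : ℕ}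
    (f : SchwartzMap (EuclideanSpace ℝ (Fin d)) ℂ) {p : ℝ} (hp : 0 < p) :
    Integrable (fun x => ‖f x‖ ^ p) := by
  have h := (f.memLp (ENNReal.ofReal p) volume).integrable_norm_rpow
    (by simpa using hp) ENNReal.ofReal_ne_top
  simpa [ENNReal.toReal_ofReal hp.le] using h

theorem SchwartzMap.integrable_sum_norm_fderiv_single_sq {d : ℕ}
    (f : SchwartzMap (EuclideanSpace ℝ (Fin d)) ℂ) :
    Integrable (fun x => ∑ j : Fin d, ‖fderiv ℝ f x (EuclideanSpace.single j 1)‖ ^ 2) := by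
  refine integrable_finsetSum _ fun j _ => ?_
  have h := (LineDeriv.lineDerivOp (EuclideanSpace.single j (1 : ℝ)) f).integrable_norm_rpow
    (p := 2) two_pos
  simpa [SchwartzMap.lineDerivOp_apply_eq_fderiv] using h

/-- The energy inequality: with mass `M`, squared gradient norm `G` and potential term `P`
controlled by a Gagliardo–Nirenberg inequality, the product of mass and energy dominates the
comparison function at `√M √G / K`. -/
theorem comparison_le_mass_mul_energy {d K M G P : ℝ} (hd : 1 < d) (hK : 0 < K)
    (hM : 0 ≤ M) (hG : 0 ≤ G)
    (hP : P ≤ ((d + 1) / d)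
      * ((M ^ ((1 : ℝ) / 2) * G ^ ((1 : ℝ) / 2)) / K) ^ ((2 : ℝ) / (d - 1)) * G) :
    K ^ 2 / (2 * d) * (((M ^ ((1 : ℝ) / 2) * G ^ ((1 : ℝ) / 2)) / K) ^ 2
        * (d - (d - 1) * ((M ^ ((1 : ℝ) / 2) * G ^ ((1 : ℝ) / 2)) / K) ^ ((2 : ℝ) / (d - 1))))
      ≤ M * (1 / 2 * G - (d - 1) / (2 * (d + 1)) * P) := by
  set t := ((M ^ ((1 : ℝ) / 2) * G ^ ((1 : ℝ) / 2)) / K) ^ ((2 : ℝ) / (d - 1))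
  have hsq : (M ^ ((1 : ℝ) / 2) * G ^ ((1 : ℝ) / 2)) ^ 2 = M * G := by
    rw [← Real.sqrt_eq_rpow, ← Real.sqrt_eq_rpow, mul_pow, Real.sq_sqrt hM, Real.sq_sqrt hG]
  have hd0 : 0 < d := by linarith
  have hc : 0 ≤ (d - 1) / (2 * (d + 1)) := div_nonneg (by linarith) (by linarith)
  calc _ = M * (1 / 2 * G - (d - 1) / (2 * (d + 1)) * ((d + 1) / d * t * G)) := by
        rw [div_pow, hsq]
        have : d + 1 ≠ 0 := by linarith
        field_simp
    _ ≤ _ := by gcongr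

/-- coercivity below the ground state threshold. -/
theorem coercivity
    (d : ℕ) (hd : 3 ≤ d) (δ : ℝ) (hδ : δ ∈ Set.Ioo (0 : ℝ) 1) :
    ∃ δ' : ℝ, 0 < δ' ∧
      ∀ K : ℝ, 0 < K →
        (∀ g : SchwartzMap (EuclideanSpace ℝ (Fin d)) ℂ,
          (∫ x : EuclideanSpace ℝ (Fin d), ‖g x‖ ^ ((2 * ((d : ℝ) + 1)) / ((d : ℝ) - 1)))
            ≤ (((d : ℝ) + 1) / d)
              * ((((∫ x : EuclideanSpace ℝ (Fin d), ‖g x‖ ^ 2) ^ ((1 : ℝ) / 2))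
                  * ((∫ x : EuclideanSpace ℝ (Fin d),
                        ∑ j : Fin d, ‖fderiv ℝ (⇑g) x (EuclideanSpace.single j 1)‖ ^ 2)
                      ^ ((1 : ℝ) / 2))) / K) ^ ((2 : ℝ) / ((d : ℝ) - 1))
              * (∫ x : EuclideanSpace ℝ (Fin d),
                  ∑ j : Fin d, ‖fderiv ℝ (⇑g) x (EuclideanSpace.single j 1)‖ ^ 2)) →
        ∀ f : SchwartzMap (EuclideanSpace ℝ (Fin d)) ℂ,
          (∫ x : EuclideanSpace ℝ (Fin d), ‖f x‖ ^ 2)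
            * (∫ x : EuclideanSpace ℝ (Fin d),
                (1 / 2) * (∑ j : Fin d, ‖fderiv ℝ (⇑f) x (EuclideanSpace.single j 1)‖ ^ 2)
                - (((d : ℝ) - 1) / (2 * ((d : ℝ) + 1)))
                  * ‖f x‖ ^ ((2 * ((d : ℝ) + 1)) / ((d : ℝ) - 1)))
            < (1 - δ) * K ^ 2 / (2 * (d : ℝ)) →
          ((∫ x : EuclideanSpace ℝ (Fin d), ‖f x‖ ^ 2) ^ ((1 : ℝ) / 2))
            * ((∫ x : EuclideanSpace ℝ (Fin d),
                  ∑ j : Fin d, ‖fderiv ℝ (⇑f) x (EuclideanSpace.single j 1)‖ ^ 2)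
                ^ ((1 : ℝ) / 2)) ≤ K →
          ((∫ x : EuclideanSpace ℝ (Fin d), ‖f x‖ ^ 2) ^ ((1 : ℝ) / 2))
            * ((∫ x : EuclideanSpace ℝ (Fin d),
                  ∑ j : Fin d, ‖fderiv ℝ (⇑f) x (EuclideanSpace.single j 1)‖ ^ 2)
                ^ ((1 : ℝ) / 2)) < (1 - δ') * K := by
  have hd1 : (1 : ℝ) < d := by exact_mod_cast (by omega : 1 < d)
  obtain ⟨δ', hδ', h⟩ := exists_lt_sub_of_comparison_lt d δ hδ.1
  refine ⟨δ', hδ', fun K hK hGN f hE hle => ?_⟩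
  have hp : 0 < (2 * ((d : ℝ) + 1)) / ((d : ℝ) - 1) := div_pos (by linarith) (by linarith)
  rw [integral_sub (f.integrable_sum_norm_fderiv_single_sq.const_mul _)
    ((f.integrable_norm_rpow hp).const_mul _), integral_const_mul, integral_const_mul] at hE
  have hlow := (comparison_le_mass_mul_energy hd1 hK
    (integral_nonneg fun x => sq_nonneg ‖f x‖)
    (integral_nonneg fun x => Finset.sum_nonneg fun j _ => sq_nonneg _) (hGN f)).trans_lt hE
  rw [← div_lt_iff₀ hK]
  refine h _ ((div_le_one hK).2 hle) ?_
  have hpos : 0 < K ^ 2 / (2 * (d : ℝ)) := by positivity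
  refine lt_of_mul_lt_mul_left (hlow.trans_eq ?_) hpos.le
  ring
end

section
/- Let d ≥ 3, let f : ℝ^d → ℂ be differentiable at the points x, y ∈ ℝ^d, and let ξ ∈ ℝ^d. Let f^ξ denote the function z ↦ e^{i⟨z,ξ⟩} f(z). Then |f^ξ(y)|² |∇f^ξ(x)|² − Im[conj(f^ξ) ∇f^ξ](x) · Im[conj(f^ξ) ∇f^ξ](y) = |f(y)|² |∇f(x)|² − Im[conj(f) ∇f](x) · Im[conj(f) ∇f](y) + ⟨ξ, |f(y)|² Im[conj(f) ∇f](x) − |f(x)|² Im[conj(f) ∇f](y)⟩. -/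
open MeasureTheory Complex
open scoped BigOperators RealInnerProductSpace

/-- The vector of partial derivatives of `f` at `x`. -/
noncomputable def gradVec (d : ℕ) (f : EuclideanSpace ℝ (Fin d) → ℂ)
    (x : EuclideanSpace ℝ (Fin d)) (j : Fin d) : ℂ :=
  fderiv ℝ f x (EuclideanSpace.single j 1)

/-- The vector `Im[conj(f) ∇f](x)`. -/
noncomputable def momVec (d : ℕ) (f : EuclideanSpace ℝ (Fin d) → ℂ)
    (x : EuclideanSpace ℝ (Fin d)) (j : Fin d) : ℝ :=
  ((starRingEnd ℂ) (f x) * gradVec d f x j).im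

/-- The Galilean modulation `x ↦ e^{i⟨x,ξ⟩} f(x)`. -/
noncomputable def modulate (d : ℕ) (ξ : EuclideanSpace ℝ (Fin d))
    (f : EuclideanSpace ℝ (Fin d) → ℂ) : EuclideanSpace ℝ (Fin d) → ℂ :=
  fun y => Complex.exp (Complex.I * (⟪y, ξ⟫ : ℝ)) * f y

/-- Modulation preserves the pointwise modulus. -/
theorem norm_modulate (d : ℕ) (ξ : EuclideanSpace ℝ (Fin d))
    (f : EuclideanSpace ℝ (Fin d) → ℂ) (x : EuclideanSpace ℝ (Fin d)) :
    ‖modulate d ξ f x‖ = ‖f x‖ := by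
  rw [modulate, norm_mul, mul_comm Complex.I, Complex.norm_exp_ofReal_mul_I, one_mul]

/-- The gradient of the modulated function is the modulation of `∇f + i ξ f`. -/
theorem gradVec_modulate (d : ℕ) (ξ : EuclideanSpace ℝ (Fin d))
    {f : EuclideanSpace ℝ (Fin d) → ℂ} {x : EuclideanSpace ℝ (Fin d)}
    (hf : DifferentiableAt ℝ f x) (j : Fin d) :
    gradVec d (modulate d ξ f) x j =
      Complex.exp (Complex.I * (⟪x, ξ⟫ : ℝ)) * (gradVec d f x j + Complex.I * ξ j * f x) := by
  have hinner : HasFDerivAt (fun z : EuclideanSpace ℝ (Fin d) => ⟪z, ξ⟫) (innerSL ℝ ξ) x := by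
    simp only [real_inner_comm ξ]
    exact (innerSL ℝ ξ).hasFDerivAt
  have hphase := ((Complex.ofRealCLM.hasFDerivAt.comp x hinner).const_mul Complex.I).cexp
  have hmod : HasFDerivAt (modulate d ξ f) _ x := hphase.mul hf.hasFDerivAt
  rw [gradVec, hmod.fderiv]
  simp [gradVec, EuclideanSpace.inner_single_right]
  ring

theorem momVec_modulate (d : ℕ) (ξ : EuclideanSpace ℝ (Fin d))
    {f : EuclideanSpace ℝ (Fin d) → ℂ} {x : EuclideanSpace ℝ (Fin d)}
    (hf : DifferentiableAt ℝ f x) (j : Fin d) :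
    momVec d (modulate d ξ f) x j = momVec d f x j + ξ j * ‖f x‖ ^ 2 := by
  have hunit : (starRingEnd ℂ) (Complex.exp (Complex.I * (⟪x, ξ⟫ : ℝ))) *
      Complex.exp (Complex.I * (⟪x, ξ⟫ : ℝ)) = 1 := by
    rw [Complex.conj_mul', mul_comm Complex.I, Complex.norm_exp_ofReal_mul_I]
    norm_num
  have hprod : (starRingEnd ℂ) (modulate d ξ f x) * gradVec d (modulate d ξ f) x j =
      (starRingEnd ℂ) (f x) * (gradVec d f x j + Complex.I * ξ j * f x) := by
    rw [gradVec_modulate d ξ hf, modulate, map_mul]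
    linear_combination
      (starRingEnd ℂ) (f x) * (gradVec d f x j + Complex.I * ξ j * f x) * hunit
  rw [momVec, hprod, momVec, Complex.sq_norm, Complex.normSq_apply]
  simp
  ring

theorem norm_gradVec_modulate_sq (d : ℕ) (ξ : EuclideanSpace ℝ (Fin d))
    {f : EuclideanSpace ℝ (Fin d) → ℂ} {x : EuclideanSpace ℝ (Fin d)}
    (hf : DifferentiableAt ℝ f x) (j : Fin d) :
    ‖gradVec d (modulate d ξ f) x j‖ ^ 2 =
      ‖gradVec d f x j‖ ^ 2 + 2 * ξ j * momVec d f x j + ξ j ^ 2 * ‖f x‖ ^ 2 := by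
  rw [gradVec_modulate d ξ hf, norm_mul, mul_comm Complex.I (⟪x, ξ⟫ : ℝ),
    Complex.norm_exp_ofReal_mul_I, one_mul, momVec]
  simp only [Complex.sq_norm, Complex.normSq_apply]
  simp
  ring

/-- pointwise Galilean identity for the interaction Morawetz integrand. -/
theorem interaction_integrand_galilean
    (d : ℕ) (hd : 3 ≤ d) (f : EuclideanSpace ℝ (Fin d) → ℂ)
    (x y : EuclideanSpace ℝ (Fin d))
    (hfx : DifferentiableAt ℝ f x) (hfy : DifferentiableAt ℝ f y)
    (ξ : EuclideanSpace ℝ (Fin d)) :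
    ‖modulate d ξ f y‖ ^ 2 * (∑ j : Fin d, ‖gradVec d (modulate d ξ f) x j‖ ^ 2)
      - (∑ j : Fin d, momVec d (modulate d ξ f) x j * momVec d (modulate d ξ f) y j)
    = ‖f y‖ ^ 2 * (∑ j : Fin d, ‖gradVec d f x j‖ ^ 2)
      - (∑ j : Fin d, momVec d f x j * momVec d f y j)
      + ∑ j : Fin d, ξ j * (‖f y‖ ^ 2 * momVec d f x j - ‖f x‖ ^ 2 * momVec d f y j) := by
  simp only [norm_modulate, norm_gradVec_modulate_sq d ξ hfx, momVec_modulate d ξ hfx,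
    momVec_modulate d ξ hfy, Finset.mul_sum, ← Finset.sum_sub_distrib, ← Finset.sum_add_distrib]
  refine Finset.sum_congr rfl fun j _ => ?_
  ring
end

section
/- Let d ≥ 3, let w : ℝ^d → ℝ be a bounded measurable function that is nonnegative and even (w(−z) = w(z)), and let u : ℝ^d → ℂ be a Schwartz function. For z ∈ ℝ^d \ {0}, let P(z) denote the orthogonal projection of ℝ^d onto the hyperplane orthogonal to z, i.e. P(z)v = v − |z|^{−2} ⟨z,v⟩ z, extended componentwise (ℂ-linearly) to ℂ^d. Then ∬_{x ≠ y} w(x−y) { |u(y)|² |P(x−y)∇u(x)|² − ⟨P(x−y) Im[conj(u) ∇u](y), P(x−y) Im[conj(u) ∇u](x)⟩ } dx dy ≥ 0. -/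
open MeasureTheory Complex
open scoped BigOperators RealInnerProductSpace

/-- Projection onto the hyperplane orthogonal to `z`, applied to a real vector. -/
noncomputable def projR (d : ℕ) (z : EuclideanSpace ℝ (Fin d))
    (v : Fin d → ℝ) (j : Fin d) : ℝ :=
  v j - (‖z‖ ^ 2)⁻¹ * (∑ k : Fin d, z k * v k) * z j

/-- Projection onto the hyperplane orthogonal to `z`, extended ℂ-linearly to `ℂ^d`. -/
noncomputable def projC (d : ℕ) (z : EuclideanSpace ℝ (Fin d))
    (v : Fin d → ℂ) (j : Fin d) : ℂ :=
  v j - ((‖z‖ : ℂ) ^ 2)⁻¹ * (∑ k : Fin d, (z k : ℂ) * v k) * (z j : ℂ)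

theorem projC_neg (d : ℕ) (z : EuclideanSpace ℝ (Fin d)) (v : Fin d → ℂ) (j : Fin d) :
    projC d (-z) v j = projC d z v j := by
  simp [projC]

theorem projR_neg (d : ℕ) (z : EuclideanSpace ℝ (Fin d)) (v : Fin d → ℝ) (j : Fin d) :
    projR d (-z) v j = projR d z v j := by
  simp [projR]

theorem projR_im (d : ℕ) (z : EuclideanSpace ℝ (Fin d)) (v : Fin d → ℂ) (j : Fin d) :
    projR d z (fun k => (v k).im) j = (projC d z v j).im := by
  have h : ((‖z‖ : ℂ) ^ 2)⁻¹ = (((‖z‖ ^ 2)⁻¹ : ℝ) : ℂ) := by push_cast; rfl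
  simp only [projR, projC, h, Complex.sub_im, Complex.im_mul_ofReal, Complex.im_ofReal_mul,
    Complex.im_sum]

theorem projC_const_mul (d : ℕ) (z : EuclideanSpace ℝ (Fin d)) (c : ℂ) (v : Fin d → ℂ)
    (j : Fin d) : projC d z (fun k => c * v k) j = c * projC d z v j := by
  simp only [projC, mul_left_comm _ c, ← Finset.mul_sum]
  ring

theorem abs_projR_momVec_le (d : ℕ) (f : EuclideanSpace ℝ (Fin d) → ℂ)
    (z x : EuclideanSpace ℝ (Fin d)) (j : Fin d) :
    |projR d z (momVec d f x) j| ≤ ‖f x‖ * ‖projC d z (gradVec d f x) j‖ := by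
  have h : projR d z (momVec d f x) j
      = ((starRingEnd ℂ) (f x) * projC d z (gradVec d f x) j).im := by
    rw [← projC_const_mul, ← projR_im]
    rfl
  rw [h]
  exact (Complex.abs_im_le_norm _).trans_eq (by rw [norm_mul, RCLike.norm_conj])

/-- The symmetrized angular integrand is pointwise nonnegative. -/
theorem two_mul_sum_projR_momVec_le (d : ℕ) (f : EuclideanSpace ℝ (Fin d) → ℂ)
    (z x y : EuclideanSpace ℝ (Fin d)) :
    2 * ∑ j : Fin d, projR d z (momVec d f y) j * projR d z (momVec d f x) j
      ≤ ‖f y‖ ^ 2 * (∑ j : Fin d, ‖projC d z (gradVec d f x) j‖ ^ 2)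
        + ‖f x‖ ^ 2 * (∑ j : Fin d, ‖projC d z (gradVec d f y) j‖ ^ 2) := by
  rw [Finset.mul_sum, Finset.mul_sum, Finset.mul_sum, ← Finset.sum_add_distrib]
  refine Finset.sum_le_sum fun j _ => ?_
  have h := mul_le_mul (abs_projR_momVec_le d f z y j) (abs_projR_momVec_le d f z x j)
    (abs_nonneg _) (by positivity)
  rw [← abs_mul] at h
  have h' := (le_abs_self _).trans h
  nlinarith [sq_nonneg (‖f y‖ * ‖projC d z (gradVec d f x) j‖
    - ‖f x‖ * ‖projC d z (gradVec d f y) j‖)]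

/-- An integral over a swap-invariant set is nonnegative if the symmetrized integrand is. -/
theorem setIntegral_nonneg_of_add_swap_nonneg {α : Type*} [MeasurableSpace α] {μ : Measure α}
    [SFinite μ] {s : Set (α × α)} (hs : Prod.swap ⁻¹' s = s) {F : α × α → ℝ}
    (hF : ∀ p, 0 ≤ F p + F p.swap) : 0 ≤ ∫ p in s, F p ∂(μ.prod μ) := by
  by_cases hi : IntegrableOn F s (μ.prod μ)
  · have hmp : MeasurePreserving Prod.swap (μ.prod μ) (μ.prod μ) :=
      Measure.measurePreserving_swap
    have hemb : MeasurableEmbedding (Prod.swap : α × α → α × α) :=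
      MeasurableEquiv.prodComm.measurableEmbedding
    have hswap : ∫ p in s, F p.swap ∂(μ.prod μ) = ∫ p in s, F p ∂(μ.prod μ) := by
      simpa only [hs] using hmp.setIntegral_preimage_emb hemb F s
    have hi' : IntegrableOn (fun p => F p.swap) s (μ.prod μ) := by
      simpa only [hs, Function.comp_def] using
        (hmp.integrableOn_comp_preimage hemb (f := F) (s := s)).2 hi
    have h : 0 ≤ ∫ p in s, (F p + F p.swap) ∂(μ.prod μ) := integral_nonneg hF
    rw [integral_add hi hi', hswap] at h
    linarith
  · exact (integral_undef hi).ge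

/-- nonnegativity of the angular part of the interaction Morawetz integrand. -/
theorem angular_part_nonneg
    (d : ℕ) (hd : 3 ≤ d) (w : EuclideanSpace ℝ (Fin d) → ℝ)
    (hw_bdd : ∃ C : ℝ, ∀ z, |w z| ≤ C) (hw_meas : Measurable w)
    (hw_nonneg : ∀ z, 0 ≤ w z) (hw_even : ∀ z, w (-z) = w z)
    (u : SchwartzMap (EuclideanSpace ℝ (Fin d)) ℂ) :
    0 ≤ ∫ p in {p : EuclideanSpace ℝ (Fin d) × EuclideanSpace ℝ (Fin d) | p.1 ≠ p.2},
        w (p.1 - p.2) *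
          (‖u p.2‖ ^ 2 * (∑ j : Fin d, ‖projC d (p.1 - p.2) (gradVec d (⇑u) p.1) j‖ ^ 2)
            - ∑ j : Fin d,
                projR d (p.1 - p.2) (momVec d (⇑u) p.2) j
                  * projR d (p.1 - p.2) (momVec d (⇑u) p.1) j) := by
  refine setIntegral_nonneg_of_add_swap_nonneg (by ext p; simp [eq_comm]) fun p => ?_
  have hz : p.2 - p.1 = -(p.1 - p.2) := (neg_sub _ _).symm
  simp only [Prod.fst_swap, Prod.snd_swap, hz, hw_even, projC_neg, projR_neg]
  rw [← mul_add]
  refine mul_nonneg (hw_nonneg _) ?_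
  have h := two_mul_sum_projR_momVec_le d u (p.1 - p.2) p.1 p.2
  have hc : ∑ j : Fin d, projR d (p.1 - p.2) (momVec d u p.1) j
        * projR d (p.1 - p.2) (momVec d u p.2) j
      = ∑ j : Fin d, projR d (p.1 - p.2) (momVec d u p.2) j
        * projR d (p.1 - p.2) (momVec d u p.1) j :=
    Finset.sum_congr rfl fun j _ => mul_comm _ _
  linarith
end

section
/- Let d ≥ 3, R > 0, L ≥ 0, and let φ₀ : [0,∞) → [0,1] be nonincreasing, Lipschitz continuous with Lipschitz constant L, and satisfy φ₀(r) = 0 for all r ≥ 2R. Define φ(x) = φ₀(|x|) for x ∈ ℝ^d and ψ(x) = (1/|x|) ∫₀^{|x|} φ₀(r) dr for x ≠ 0. Then for every x ∈ ℝ^d \ {0}: 0 ≤ ψ(x) − φ(x) ≤ min{L|x|/2, 2R/|x|}. -/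
open MeasureTheory
open scoped BigOperators

/-- The radial average `ψ(x) = |x|⁻¹ ∫₀^{|x|} φ₀(r) dr`. -/
noncomputable def psiAvg (d : ℕ) (φ₀ : ℝ → ℝ) (x : EuclideanSpace ℝ (Fin d)) : ℝ :=
  (1 / ‖x‖) * ∫ r in (0 : ℝ)..‖x‖, φ₀ r

/-- An antitone function on `[0, ∞)` is at most its average over `[0, a]`. -/
lemma mul_le_integral_of_antitoneOn {f : ℝ → ℝ} (hf : AntitoneOn f (Set.Ici 0)) {a : ℝ}
    (ha : 0 ≤ a) : a * f a ≤ ∫ r in (0 : ℝ)..a, f r := by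
  have hint : IntervalIntegrable f volume 0 a :=
    (hf.mono (by rw [Set.uIcc_of_le ha]; exact Set.Icc_subset_Ici_self)).intervalIntegrable
  have h := intervalIntegral.integral_mono_on ha intervalIntegrable_const hint
    fun r hr => hf hr.1 ha hr.2
  simpa using h

/-- A one-sided Lipschitz bound at the right endpoint bounds the integral over `[0, a]`. -/
lemma integral_le_of_le_add_mul_sub {f : ℝ → ℝ} {a L : ℝ} (ha : 0 ≤ a)
    (hint : IntervalIntegrable f volume 0 a)
    (hf : ∀ r ∈ Set.Icc 0 a, f r ≤ f a + L * (a - r)) :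
    ∫ r in (0 : ℝ)..a, f r ≤ a * f a + L * a ^ 2 / 2 := by
  have hlin : IntervalIntegrable (fun r => L * (a - r)) volume 0 a :=
    Continuous.intervalIntegrable (by fun_prop) _ _
  refine (intervalIntegral.integral_mono_on ha hint
    (intervalIntegrable_const.add hlin) hf).trans_eq ?_
  rw [intervalIntegral.integral_add intervalIntegrable_const hlin,
    intervalIntegral.integral_const_mul,
    intervalIntegral.integral_sub intervalIntegrable_const intervalIntegral.intervalIntegrable_id,
    integral_id]
  simp
  ring

/-- A function bounded by `1` on `[0, ∞)` and vanishing on `[c, ∞)` has integral at most `c`. -/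
lemma integral_le_of_le_one_of_eq_zero {f : ℝ → ℝ} {a c : ℝ} (ha : 0 ≤ a) (hc : 0 ≤ c)
    (hint : ∀ b, 0 ≤ b → IntervalIntegrable f volume 0 b)
    (hf : ∀ r, 0 ≤ r → f r ≤ 1) (hf' : ∀ r, c ≤ r → f r = 0) :
    ∫ r in (0 : ℝ)..a, f r ≤ c := by
  have hle : ∀ b, 0 ≤ b → ∫ r in (0 : ℝ)..b, f r ≤ b := fun b hb => by
    simpa using intervalIntegral.integral_mono_on hb (hint b hb) intervalIntegrable_const
      fun r hr => hf r hr.1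
  rcases le_total a c with h | h
  · exact (hle a ha).trans h
  · have hzero : ∫ r in c..a, f r = 0 :=
      intervalIntegral.integral_zero_ae <| Filter.Eventually.of_forall fun r hr => by
        rw [Set.uIoc_of_le h] at hr
        exact hf' r hr.1.le
    rw [← intervalIntegral.integral_add_adjacent_intervals (hint c hc)
      ((hint c hc).symm.trans (hint a ha)), hzero, add_zero]
    exact hle c hc

/-- pointwise bounds for `ψ − φ`. -/
theorem psi_minus_phi_bounds
    (d : ℕ) (hd : 3 ≤ d) (R : ℝ) (hR : 0 < R) (L : ℝ) (hL : 0 ≤ L) (φ₀ : ℝ → ℝ)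
    (hφ₀_range : ∀ r : ℝ, 0 ≤ r → φ₀ r ∈ Set.Icc (0 : ℝ) 1)
    (hφ₀_mono : AntitoneOn φ₀ (Set.Ici 0))
    (hφ₀_lip : ∀ r s : ℝ, 0 ≤ r → 0 ≤ s → |φ₀ r - φ₀ s| ≤ L * |r - s|)
    (hφ₀_supp : ∀ r : ℝ, 2 * R ≤ r → φ₀ r = 0) :
    ∀ x : EuclideanSpace ℝ (Fin d), x ≠ 0 →
      0 ≤ psiAvg d φ₀ x - φ₀ ‖x‖
      ∧ psiAvg d φ₀ x - φ₀ ‖x‖ ≤ min (L * ‖x‖ / 2) (2 * R / ‖x‖) := by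
  intro x hx
  have ha : 0 < ‖x‖ := norm_pos_iff.2 hx
  have hint : ∀ b, 0 ≤ b → IntervalIntegrable φ₀ volume 0 b := fun b hb =>
    (hφ₀_mono.mono (by
      rw [Set.uIcc_of_le hb]; exact Set.Icc_subset_Ici_self)).intervalIntegrable
  have hpsi : psiAvg d φ₀ x - φ₀ ‖x‖ = ((∫ r in (0 : ℝ)..‖x‖, φ₀ r) - ‖x‖ * φ₀ ‖x‖) / ‖x‖ := by
    unfold psiAvg
    field_simp
  have hlip := integral_le_of_le_add_mul_sub (L := L) ha.le (hint _ ha.le) fun r hr => by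
    have h := (le_abs_self _).trans (hφ₀_lip r ‖x‖ hr.1 ha.le)
    rw [abs_sub_comm, abs_of_nonneg (sub_nonneg.2 hr.2)] at h
    linarith
  have hsupp := integral_le_of_le_one_of_eq_zero ha.le (by positivity : 0 ≤ 2 * R) hint
    (fun r hr => (hφ₀_range r hr).2) hφ₀_supp
  rw [hpsi]
  refine ⟨div_nonneg (sub_nonneg.2 (mul_le_integral_of_antitoneOn hφ₀_mono ha.le)) ha.le,
    le_min ?_ ?_⟩
  · rw [div_le_iff₀ ha]
    linarith
  · have := mul_nonneg ha.le (hφ₀_range _ ha.le).1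
    gcongr
    linarith
end

section
/- Let d ≥ 3, ε ∈ (0,1), R > 0, and let χ : ℝ^d → [0,1] be a measurable radial function (χ(x) depends only on |x|) with χ(x) = 1 for |x| ≤ 1−ε and χ(x) = 0 for |x| > 1. Define φ(x) = (1/(ω_d R^d)) ∫_{ℝ^d} χ((x−s)/R)² χ(s/R)² ds and φ₁(x,y) = (1/(ω_d R^d)) ∫_{ℝ^d} χ((y−s)/R)² χ((x−s)/R)^{2(d+1)/(d-1)} ds, where ω_d is the Lebesgue measure of the unit ball in ℝ^d. Then for all x, y ∈ ℝ^d: 0 ≤ φ(x−y) − φ₁(x,y) ≤ 1 − (1−ε)^d ≤ dε. -/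
open MeasureTheory
open scoped BigOperators

/-- The Euclidean shell with radii `(1 - ε) * R` and `R` has volume `ω_d * R ^ d * (1 - (1 - ε) ^ d)`. -/
theorem volume_real_shell {d : ℕ} {ε R : ℝ} (hε : ε ∈ Set.Ioo (0 : ℝ) 1) (hR : 0 < R) :
    volume.real (Metric.closedBall (0 : EuclideanSpace ℝ (Fin d)) R \
        Metric.closedBall 0 ((1 - ε) * R))
      = (volume (Metric.ball (0 : EuclideanSpace ℝ (Fin d)) 1)).toReal * R ^ d
          * (1 - (1 - ε) ^ d) := by
  have hr : 0 ≤ (1 - ε) * R := mul_nonneg (by linarith [hε.2]) hR.le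
  have hle : (1 - ε) * R ≤ R := by nlinarith [hε.1]
  have hball (r : ℝ) (h : 0 ≤ r) :
      volume.real (Metric.closedBall (0 : EuclideanSpace ℝ (Fin d)) r)
        = r ^ d * (volume (Metric.ball (0 : EuclideanSpace ℝ (Fin d)) 1)).toReal := by
    rw [measureReal_def, Measure.addHaar_closedBall _ _ h, ENNReal.toReal_mul,
      ENNReal.toReal_ofReal (by positivity), finrank_euclideanSpace_fin]
  rw [measureReal_sdiff (Metric.closedBall_subset_closedBall hle)
    Metric.isClosed_closedBall.measurableSet measure_closedBall_lt_top.ne, hball R hR.le, hball _ hr, mul_pow]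
  ring

/-- comparison of the convolution weights `φ` and `φ₁`. -/
theorem phi_phi1_comparison
    (d : ℕ) (hd : 3 ≤ d) (ε : ℝ) (hε : ε ∈ Set.Ioo (0 : ℝ) 1) (R : ℝ) (hR : 0 < R)
    (χ : EuclideanSpace ℝ (Fin d) → ℝ) (hχ_meas : Measurable χ)
    (hχ_range : ∀ x, χ x ∈ Set.Icc (0 : ℝ) 1)
    (hχ_radial : ∀ x y : EuclideanSpace ℝ (Fin d), ‖x‖ = ‖y‖ → χ x = χ y)
    (hχ_one : ∀ x : EuclideanSpace ℝ (Fin d), ‖x‖ ≤ 1 - ε → χ x = 1)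
    (hχ_zero : ∀ x : EuclideanSpace ℝ (Fin d), 1 < ‖x‖ → χ x = 0) :
    ∀ x y : EuclideanSpace ℝ (Fin d),
      0 ≤ (1 / ((volume (Metric.ball (0 : EuclideanSpace ℝ (Fin d)) 1)).toReal * R ^ d))
            * (∫ s : EuclideanSpace ℝ (Fin d),
                χ (R⁻¹ • ((x - y) - s)) ^ 2 * χ (R⁻¹ • s) ^ 2)
          - (1 / ((volume (Metric.ball (0 : EuclideanSpace ℝ (Fin d)) 1)).toReal * R ^ d))
            * (∫ s : EuclideanSpace ℝ (Fin d),
                χ (R⁻¹ • (y - s)) ^ 2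
                  * χ (R⁻¹ • (x - s)) ^ ((2 * ((d : ℝ) + 1)) / ((d : ℝ) - 1)))
      ∧ (1 / ((volume (Metric.ball (0 : EuclideanSpace ℝ (Fin d)) 1)).toReal * R ^ d))
            * (∫ s : EuclideanSpace ℝ (Fin d),
                χ (R⁻¹ • ((x - y) - s)) ^ 2 * χ (R⁻¹ • s) ^ 2)
          - (1 / ((volume (Metric.ball (0 : EuclideanSpace ℝ (Fin d)) 1)).toReal * R ^ d))
            * (∫ s : EuclideanSpace ℝ (Fin d),
                χ (R⁻¹ • (y - s)) ^ 2
                  * χ (R⁻¹ • (x - s)) ^ ((2 * ((d : ℝ) + 1)) / ((d : ℝ) - 1)))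
          ≤ 1 - (1 - ε) ^ d
      ∧ 1 - (1 - ε) ^ d ≤ (d : ℝ) * ε := by
  intro x y
  have hd' : (3 : ℝ) ≤ d := by exact_mod_cast hd
  set p : ℝ := (2 * ((d : ℝ) + 1)) / ((d : ℝ) - 1) with hp
  set ω : ℝ := (volume (Metric.ball (0 : EuclideanSpace ℝ (Fin d)) 1)).toReal with hω
  have hω_pos : 0 < ω := ENNReal.toReal_pos
    (Metric.measure_ball_pos volume _ one_pos).ne' measure_ball_lt_top.ne
  have hp2 : 2 ≤ p := by
    rw [hp, le_div_iff₀ (by linarith)]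
    linarith
  have hsubst : (∫ s, χ (R⁻¹ • (y - s)) ^ 2 * χ (R⁻¹ • (x - s)) ^ p)
      = ∫ s, χ (R⁻¹ • ((x - y) - s)) ^ 2 * χ (R⁻¹ • s) ^ p := by
    rw [← integral_sub_left_eq_self
      (fun s => χ (R⁻¹ • (y - s)) ^ 2 * χ (R⁻¹ • (x - s)) ^ p) volume x]
    congr 1 with s
    have h : χ (R⁻¹ • (y - (x - s))) = χ (R⁻¹ • ((x - y) - s)) := by
      apply hχ_radial
      rw [norm_smul, norm_smul, ← norm_neg (y - (x - s))]
      congr 2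
      abel
    rw [h, sub_sub_cancel]
  have hnorm (s : EuclideanSpace ℝ (Fin d)) : ‖R⁻¹ • s‖ = ‖s‖ / R := by
    rw [norm_smul, norm_inv, Real.norm_of_nonneg hR.le, div_eq_inv_mul]
  have hpow (t : ℝ) (ht : t ∈ Set.Icc (0 : ℝ) 1) : t ^ p ≤ t ^ 2 := by
    rw [← Real.rpow_natCast t 2]
    exact Real.rpow_le_rpow_of_exponent_ge' ht.1 ht.2 (by norm_num) (by exact_mod_cast hp2)
  have hsq (z : EuclideanSpace ℝ (Fin d)) : χ z ^ 2 ≤ 1 :=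
    pow_le_one₀ (hχ_range z).1 (hχ_range z).2
  have hball : Integrable
      ((Metric.closedBall (0 : EuclideanSpace ℝ (Fin d)) R).indicator fun _ => (1 : ℝ)) :=
    (integrable_indicator_iff Metric.isClosed_closedBall.measurableSet).2
      (integrableOn_const measure_closedBall_lt_top.ne)
  have hF_le (s : EuclideanSpace ℝ (Fin d)) :
      χ (R⁻¹ • ((x - y) - s)) ^ 2 * χ (R⁻¹ • s) ^ 2
        ≤ (Metric.closedBall (0 : EuclideanSpace ℝ (Fin d)) R).indicator (fun _ => (1 : ℝ)) s := by
    by_cases hs : s ∈ Metric.closedBall (0 : EuclideanSpace ℝ (Fin d)) R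
    · rw [Set.indicator_of_mem hs]
      exact mul_le_one₀ (hsq _) (sq_nonneg _) (hsq _)
    · rw [Set.indicator_of_notMem hs, hχ_zero (R⁻¹ • s)]
      · simp
      · rw [hnorm, lt_div_iff₀ hR]
        simpa using hs
  have hG_le (s : EuclideanSpace ℝ (Fin d)) :
      χ (R⁻¹ • ((x - y) - s)) ^ 2 * χ (R⁻¹ • s) ^ p
        ≤ χ (R⁻¹ • ((x - y) - s)) ^ 2 * χ (R⁻¹ • s) ^ 2 :=
    mul_le_mul_of_nonneg_left (hpow _ (hχ_range _)) (sq_nonneg _)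
  have hG_nonneg (s : EuclideanSpace ℝ (Fin d)) :
      0 ≤ χ (R⁻¹ • ((x - y) - s)) ^ 2 * χ (R⁻¹ • s) ^ p :=
    mul_nonneg (sq_nonneg _) (Real.rpow_nonneg (hχ_range _).1 _)
  have hF : Integrable fun s => χ (R⁻¹ • ((x - y) - s)) ^ 2 * χ (R⁻¹ • s) ^ 2 := by
    refine hball.mono' (Measurable.aestronglyMeasurable (by fun_prop)) (.of_forall fun s => ?_)
    rw [Real.norm_of_nonneg (by positivity)]
    exact hF_le s
  have hG : Integrable fun s => χ (R⁻¹ • ((x - y) - s)) ^ 2 * χ (R⁻¹ • s) ^ p := by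
    refine hF.mono' (Measurable.aestronglyMeasurable (by fun_prop)) (.of_forall fun s => ?_)
    rw [Real.norm_of_nonneg (hG_nonneg s)]
    exact hG_le s
  set S := Metric.closedBall (0 : EuclideanSpace ℝ (Fin d)) R \
    Metric.closedBall 0 ((1 - ε) * R)
  have hS_meas : MeasurableSet S :=
    Metric.isClosed_closedBall.measurableSet.diff Metric.isClosed_closedBall.measurableSet
  have hdiff_le (s : EuclideanSpace ℝ (Fin d)) :
      χ (R⁻¹ • ((x - y) - s)) ^ 2 * χ (R⁻¹ • s) ^ 2
        - χ (R⁻¹ • ((x - y) - s)) ^ 2 * χ (R⁻¹ • s) ^ p ≤ S.indicator (fun _ => (1 : ℝ)) s := by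
    by_cases hs : s ∈ Metric.closedBall (0 : EuclideanSpace ℝ (Fin d)) ((1 - ε) * R)
    · have h1 : χ (R⁻¹ • s) = 1 := by
        apply hχ_one
        rw [hnorm, div_le_iff₀ hR]
        simpa using hs
      simp only [h1, one_pow, Real.one_rpow, sub_self]
      exact Set.indicator_nonneg (fun _ _ => zero_le_one) s
    · have hmem : S.indicator (fun _ => (1 : ℝ)) s
          = (Metric.closedBall (0 : EuclideanSpace ℝ (Fin d)) R).indicator (fun _ => 1) s := by
        have hiff : s ∈ S ↔ s ∈ Metric.closedBall (0 : EuclideanSpace ℝ (Fin d)) R :=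
          and_iff_left hs
        by_cases hb : s ∈ Metric.closedBall (0 : EuclideanSpace ℝ (Fin d)) R
        · rw [Set.indicator_of_mem hb, Set.indicator_of_mem (hiff.2 hb)]
        · rw [Set.indicator_of_notMem hb, Set.indicator_of_notMem (mt hiff.1 hb)]
      rw [hmem]
      linarith [hF_le s, hG_nonneg s]
  have hS_int : Integrable (S.indicator fun _ => (1 : ℝ)) :=
    (integrable_indicator_iff hS_meas).2 (integrableOn_const
      (measure_lt_top_of_subset Set.sdiff_subset measure_closedBall_lt_top.ne).ne)
  have hupper := integral_mono (hF.sub hG) hS_int hdiff_le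
  rw [integral_indicator_const _ hS_meas, volume_real_shell hε hR, smul_eq_mul, mul_one,
    ← hω] at hupper
  simp only [Pi.sub_apply] at hupper
  have hden : 0 < ω * R ^ d := by positivity
  rw [hsubst, ← mul_sub, ← integral_sub hF hG]
  refine ⟨mul_nonneg (by positivity) (integral_nonneg fun s => sub_nonneg.2 (hG_le s)), ?_, ?_⟩
  · rwa [one_div, inv_mul_le_iff₀ hden]
  · have h := one_add_mul_le_pow (a := -ε) (by linarith [hε.2]) d
    rw [← sub_eq_add_neg] at h
    linarith
end
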